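/- Let G be a generalized (m,n)-ladder graph. Then G is outerplanar if and only if one of the following holds: (i) L↑(e) ∩ R↑(e) = L↓(e) ∩ R↓(e) = ∅ for each edge e ∈ [G₁,G₂]; (ii) L↑(e) ∩ R↓(e) = L↓(e) ∩ R↑(e) = ∅ for each edge e ∈ [G₁,G₂]. -/

import Mathlib

open SimpleGraph

/-- `G` contains a subdivision of `H`: there is an injection `f` of the vertices of `H`
into the vertices of `G` and, for each edge of `H`, a path in `G` between the images of its
endpoints, such that the paths pass through no branch vertices other than their own endpoints
and paths corresponding to distinct edges are internally disjoint. -/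
def ContainsSubdivision {V W : Type*} (G : SimpleGraph V) (H : SimpleGraph W) : Prop :=
  ∃ f : W → V, Function.Injective f ∧
    ∃ p : ∀ ⦃a b : W⦄, H.Adj a b → G.Walk (f a) (f b),
      (∀ ⦃a b : W⦄ (h : H.Adj a b), (p h).IsPath) ∧
      (∀ ⦃a b : W⦄ (h : H.Adj a b) (w : W), f w ∈ (p h).support → w = a ∨ w = b) ∧
      (∀ ⦃a b a' b' : W⦄ (h : H.Adj a b) (h' : H.Adj a' b'), s(a, b) ≠ s(a', b') →
        ∀ v, v ∈ (p h).support → v ∈ (p h').support →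
          (v = f a ∨ v = f b) ∧ (v = f a' ∨ v = f b'))

/-- A graph is planar iff it contains no subdivision of `K₅` or `K₃,₃` (Kuratowski). -/
def IsPlanar {V : Type*} (G : SimpleGraph V) : Prop :=
  ¬ ContainsSubdivision G (completeGraph (Fin 5)) ∧
  ¬ ContainsSubdivision G (completeBipartiteGraph (Fin 3) (Fin 3))

/-- A graph is outerplanar iff it contains no subdivision of `K₄` or `K₃,₂`
(Chartrand–Harary). -/
def IsOuterplanar {V : Type*} (G : SimpleGraph V) : Prop :=
  ¬ ContainsSubdivision G (completeGraph (Fin 4)) ∧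
  ¬ ContainsSubdivision G (completeBipartiteGraph (Fin 3) (Fin 2))

/-- The base relation of a generalized (m,n)-ladder graph: consecutive vertices on each of the
two paths are adjacent, and `u i` is adjacent to `v j` exactly when `(i, j)` is a cross edge. -/
def ladderRel (m n : ℕ) (cross : Finset (Fin m × Fin n)) :
    Fin m ⊕ Fin n → Fin m ⊕ Fin n → Prop
  | Sum.inl i, Sum.inl j => (i : ℕ) + 1 = (j : ℕ)
  | Sum.inr i, Sum.inr j => (i : ℕ) + 1 = (j : ℕ)
  | Sum.inl i, Sum.inr j => (i, j) ∈ cross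
  | Sum.inr _, Sum.inl _ => False

/-- The generalized (m,n)-ladder graph determined by the set `cross` of cross edges
`[G₁, G₂]`.  Vertices `Sum.inl i` are the vertices `u_{i+1}` of the path `G₁` and
vertices `Sum.inr j` are the vertices `v_{j+1}` of the path `G₂`. -/
def ladderGraph (m n : ℕ) (cross : Finset (Fin m × Fin n)) :
    SimpleGraph (Fin m ⊕ Fin n) :=
  SimpleGraph.fromRel (ladderRel m n cross)

/-- `L↑(e)`: the cross edges `e'` with `l(e) < l(e')`. -/
def Lup {m n : ℕ} (cross : Finset (Fin m × Fin n)) (e : Fin m × Fin n) :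
    Finset (Fin m × Fin n) := cross.filter fun e' => e.1 < e'.1

/-- `L↓(e)`: the cross edges `e'` with `l(e') < l(e)`. -/
def Ldown {m n : ℕ} (cross : Finset (Fin m × Fin n)) (e : Fin m × Fin n) :
    Finset (Fin m × Fin n) := cross.filter fun e' => e'.1 < e.1

/-- `R↑(e)`: the cross edges `e'` with `r(e) < r(e')`. -/
def Rup {m n : ℕ} (cross : Finset (Fin m × Fin n)) (e : Fin m × Fin n) :
    Finset (Fin m × Fin n) := cross.filter fun e' => e.2 < e'.2

/-- `R↓(e)`: the cross edges `e'` with `r(e') < r(e)`. -/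
def Rdown {m n : ℕ} (cross : Finset (Fin m × Fin n)) (e : Fin m × Fin n) :
    Finset (Fin m × Fin n) := cross.filter fun e' => e'.2 < e.2

section Subdivision

variable {V V' W E : Type*} {G : SimpleGraph V} {G' : SimpleGraph V'} {H : SimpleGraph W}

/-- A subdivision may be given by connecting the ends of every edge inside prescribed regions
that meet only in common branch vertices. -/
theorem containsSubdivision_of_regions (f : W → V) (hf : Function.Injective f)
    (src tgt : E → W) (T : E → Set V)
    (hE : ∀ a b, H.Adj a b → ∃ e, s(a, b) = s(src e, tgt e))
    (hw : ∀ e, ∃ p : G.Walk (f (src e)) (f (tgt e)), ∀ v ∈ p.support, v ∈ T e)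
    (hb : ∀ e w, f w ∈ T e → w = src e ∨ w = tgt e)
    (hd : ∀ e e', e ≠ e' → ∀ v, v ∈ T e → v ∈ T e' → v = f (src e) ∨ v = f (tgt e)) :
    ContainsSubdivision G H := by
  classical
  have key : ∀ (a b : W) (_ : H.Adj a b), ∃ q : G.Walk (f a) (f b), q.IsPath ∧
      ∃ e, s(a, b) = s(src e, tgt e) ∧ ∀ v ∈ q.support, v ∈ T e := by
    intro a b h
    obtain ⟨e, he⟩ := hE a b h
    obtain ⟨p, hp⟩ := hw e
    rcases Sym2.eq_iff.1 he with ⟨rfl, rfl⟩ | ⟨rfl, rfl⟩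
    · exact ⟨p.bypass, p.bypass_isPath, e, he, fun v hv => hp v (p.support_bypass_subset_support hv)⟩
    · refine ⟨p.reverse.bypass, p.reverse.bypass_isPath, e, he, fun v hv => hp v ?_⟩
      simpa using p.reverse.support_bypass_subset_support hv
  choose q hq e he hT using key
  refine ⟨f, hf, fun a b h => q a b h, fun a b h => hq a b h, ?_, ?_⟩
  · intro a b h w hw
    have := hb _ w (hT a b h _ hw)
    rcases Sym2.eq_iff.1 (he a b h) with ⟨h1, h2⟩ | ⟨h1, h2⟩ <;> rw [← h1, ← h2] at this <;> tauto
  · intro a b a' b' h h' hne v hv hv'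
    have hee : e a b h ≠ e a' b' h' := fun hh => hne (by rw [he a b h, he a' b' h', hh])
    have h1 := hd _ _ hee v (hT _ _ _ _ hv) (hT _ _ _ _ hv')
    have h2 := hd _ _ hee.symm v (hT _ _ _ _ hv') (hT _ _ _ _ hv)
    constructor
    · rcases Sym2.eq_iff.1 (he a b h) with ⟨h3, h4⟩ | ⟨h3, h4⟩ <;> rw [← h3, ← h4] at h1 <;> tauto
    · rcases Sym2.eq_iff.1 (he a' b' h') with ⟨h3, h4⟩ | ⟨h3, h4⟩ <;> rw [← h3, ← h4] at h2 <;> tauto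

theorem ContainsSubdivision.map (φ : G →g G') (hφ : Function.Injective φ)
    (h : ContainsSubdivision G H) : ContainsSubdivision G' H := by
  obtain ⟨f, hf, p, h1, h2, h3⟩ := h
  refine ⟨φ ∘ f, hφ.comp hf, fun a b hab => (p hab).map φ, ?_, ?_, ?_⟩
  · exact fun a b hab => (h1 hab).map hφ
  · intro a b hab w hw
    simp only [Walk.support_map, List.mem_map, Function.comp] at hw
    obtain ⟨x, hx, hxw⟩ := hw
    exact h2 hab w (hφ hxw ▸ hx)
  · intro a b a' b' hab hab' hne v hv hv'
    simp only [Walk.support_map, List.mem_map] at hv hv'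
    obtain ⟨x, hx, rfl⟩ := hv
    obtain ⟨y, hy, hyx⟩ := hv'
    obtain rfl := hφ hyx
    have := h3 hab hab' hne _ hx hy
    simp only [Function.comp, hφ.eq_iff]
    exact this

theorem IsOuterplanar.of_injective_hom (φ : G →g G') (hφ : Function.Injective φ)
    (h : IsOuterplanar G') : IsOuterplanar G :=
  ⟨fun hs => h.1 (hs.map φ hφ), fun hs => h.2 (hs.map φ hφ)⟩

end Subdivision

section NonCrossing

variable {V : Type*} {G : SimpleGraph V}

/-- In a graph whose edges do not cross with respect to a linear arrangement of the vertices,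
vertex-disjoint walks do not cross either. -/
theorem sep_iff_of_disjoint_walks {pos : V → ℕ} (hpos : Function.Injective pos)
    (hG : ∀ a b c d, G.Adj a b → G.Adj c d →
      ¬ (pos a < pos c ∧ pos c < pos b ∧ pos b < pos d))
    {a b c d : V} (P : G.Walk a b) (Q : G.Walk c d)
    (hPQ : ∀ v, v ∈ P.support → v ∈ Q.support → False) :
    ((pos a < pos c ↔ pos b < pos c) ↔ (pos a < pos d ↔ pos b < pos d)) := by
  have edge : ∀ {a b z w : V} (P : G.Walk a b), G.Adj z w → z ∉ P.support → w ∉ P.support →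
      ((pos a < pos z ↔ pos b < pos z) ↔ (pos a < pos w ↔ pos b < pos w)) := by
    intro a b z w P hzw
    induction P with
    | nil => simp
    | @cons a x b h P ih =>
      intro hz hw
      simp only [Walk.support_cons, List.mem_cons, not_or] at hz hw
      have ih := ih hz.2 hw.2
      have hxz : x ≠ z := fun h => hz.2 (h ▸ P.start_mem_support)
      have hxw : x ≠ w := fun h => hw.2 (h ▸ P.start_mem_support)
      have n1 := hpos.ne hxz
      have n2 := hpos.ne hxw
      have n3 := hpos.ne hz.1
      have n4 := hpos.ne hw.1
      have n5 := hpos.ne h.ne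
      have n6 := hpos.ne hzw.ne
      have k1 := hG _ _ _ _ h hzw
      have k2 := hG _ _ _ _ h hzw.symm
      have k3 := hG _ _ _ _ h.symm hzw
      have k4 := hG _ _ _ _ h.symm hzw.symm
      have k5 := hG _ _ _ _ hzw h
      have k6 := hG _ _ _ _ hzw.symm h
      have k7 := hG _ _ _ _ hzw h.symm
      have k8 := hG _ _ _ _ hzw.symm h.symm
      have : ((pos a < pos z ↔ pos x < pos z) ↔ (pos a < pos w ↔ pos x < pos w)) := by
        grind
      clear ih n1 n2 n3 n4 n5 n6 k1 k2 k3 k4 k5 k6 k7 k8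
      grind
  induction Q with
  | nil => rfl
  | @cons c x d h Q ih =>
    simp only [Walk.support_cons, List.mem_cons] at hPQ
    exact (edge P h (fun hc => hPQ _ hc (Or.inl rfl))
      (fun hc => hPQ _ hc (Or.inr Q.start_mem_support))).trans
      (ih fun v hv hv' => hPQ v hv (Or.inr hv'))

theorem isOuterplanar_of_noncrossing {pos : V → ℕ} (hpos : Function.Injective pos)
    (hG : ∀ a b c d, G.Adj a b → G.Adj c d →
      ¬ (pos a < pos c ∧ pos c < pos b ∧ pos b < pos d)) :
    IsOuterplanar G := by
  constructor
  · rintro ⟨f, hf, p, -, -, h3⟩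
    have key : ∀ a b c d : Fin 4, a ≠ b → c ≠ d → a ≠ c → a ≠ d → b ≠ c → b ≠ d →
        ((pos (f a) < pos (f c) ↔ pos (f b) < pos (f c)) ↔
          (pos (f a) < pos (f d) ↔ pos (f b) < pos (f d))) := by
      intro a b c d hab hcd h1 h2 h4 h5
      have Aab : (completeGraph (Fin 4)).Adj a b := hab
      have Acd : (completeGraph (Fin 4)).Adj c d := hcd
      refine sep_iff_of_disjoint_walks hpos hG (p Aab) (p Acd) fun v hv hv' => ?_
      obtain ⟨k1, k2⟩ := h3 Aab Acd (by rw [Ne, Sym2.eq_iff]; tauto) v hv hv'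
      rcases k1 with rfl | rfl <;> rcases k2 with k2 | k2 <;> have := hf k2 <;> tauto
    have e1 := key 0 1 2 3 (by decide) (by decide) (by decide) (by decide) (by decide) (by decide)
    have e2 := key 0 2 1 3 (by decide) (by decide) (by decide) (by decide) (by decide) (by decide)
    have e3 := key 0 3 1 2 (by decide) (by decide) (by decide) (by decide) (by decide) (by decide)
    have ne : ∀ i j : Fin 4, i ≠ j → pos (f i) ≠ pos (f j) := fun i j h => (hpos.comp hf).ne h
    have n1 := ne 0 1 (by decide)
    have n2 := ne 0 2 (by decide)
    have n3 := ne 0 3 (by decide)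
    have n4 := ne 1 2 (by decide)
    have n5 := ne 1 3 (by decide)
    have n6 := ne 2 3 (by decide)
    clear key ne
    grind
  · rintro ⟨f, hf, p, -, -, h3⟩
    have key : ∀ (i j : Fin 3), i ≠ j →
        ((pos (f (.inl i)) < pos (f (.inl j)) ↔ pos (f (.inr 0)) < pos (f (.inl j))) ↔
          (pos (f (.inl i)) < pos (f (.inr 1)) ↔ pos (f (.inr 0)) < pos (f (.inr 1)))) := by
      intro i j hij
      have A1 : (completeBipartiteGraph (Fin 3) (Fin 2)).Adj (.inl i) (.inr 0) := by simp
      have A2 : (completeBipartiteGraph (Fin 3) (Fin 2)).Adj (.inl j) (.inr 1) := by simp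
      refine sep_iff_of_disjoint_walks hpos hG (p A1) (p A2) fun v hv hv' => ?_
      obtain ⟨k1, k2⟩ := h3 A1 A2 (by simp) v hv hv'
      rcases k1 with rfl | rfl <;> rcases k2 with k2 | k2
      · exact hij (Sum.inl_injective (hf k2))
      · exact Sum.inl_ne_inr (hf k2)
      · exact Sum.inr_ne_inl (hf k2)
      · exact absurd (hf k2) (by decide)
    have ne : ∀ i j, i ≠ j → pos (f i) ≠ pos (f j) := fun i j h => (hpos.comp hf).ne h
    have side : ∀ i j : Fin 3, i ≠ j →
        ¬ ((pos (f (.inl i)) < pos (f (.inr 0)) ↔ pos (f (.inl i)) < pos (f (.inr 1))) ↔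
          (pos (f (.inl j)) < pos (f (.inr 0)) ↔ pos (f (.inl j)) < pos (f (.inr 1)))) := by
      intro i j hij
      have e1 := key i j hij
      have e2 := key j i hij.symm
      have n1 := ne (.inl i) (.inl j) (by simpa using hij)
      have n2 := ne (.inl i) (.inr 0) (by simp)
      have n3 := ne (.inl i) (.inr 1) (by simp)
      have n4 := ne (.inl j) (.inr 0) (by simp)
      have n5 := ne (.inl j) (.inr 1) (by simp)
      have n6 := ne (.inr 0) (.inr 1) (by decide)
      clear key ne
      grind
    have s1 := side 0 1 (by decide)
    have s2 := side 0 2 (by decide)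
    have s3 := side 1 2 (by decide)
    tauto

end NonCrossing

section Ladder

variable {m n : ℕ} {cross : Finset (Fin m × Fin n)}

@[simp]
theorem ladderGraph_adj_inl_inl {i j : Fin m} :
    (ladderGraph m n cross).Adj (.inl i) (.inl j) ↔ (i : ℕ) + 1 = j ∨ (j : ℕ) + 1 = i := by
  simp only [ladderGraph, fromRel_adj, ladderRel, ne_eq, Sum.inl.injEq, Fin.ext_iff]
  omega

@[simp]
theorem ladderGraph_adj_inr_inr {i j : Fin n} :
    (ladderGraph m n cross).Adj (.inr i) (.inr j) ↔ (i : ℕ) + 1 = j ∨ (j : ℕ) + 1 = i := by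
  simp only [ladderGraph, fromRel_adj, ladderRel, ne_eq, Sum.inr.injEq, Fin.ext_iff]
  omega

@[simp]
theorem ladderGraph_adj_inl_inr {i : Fin m} {j : Fin n} :
    (ladderGraph m n cross).Adj (.inl i) (.inr j) ↔ (i, j) ∈ cross := by
  simp [ladderGraph, ladderRel]

@[simp]
theorem ladderGraph_adj_inr_inl {i : Fin m} {j : Fin n} :
    (ladderGraph m n cross).Adj (.inr j) (.inl i) ↔ (i, j) ∈ cross := by
  simp [ladderGraph, ladderRel]

theorem isOuterplanar_ladderGraph_of_anti
    (h : ∀ e ∈ cross, ∀ e' ∈ cross, e.1 < e'.1 → ¬ e.2 < e'.2) :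
    IsOuterplanar (ladderGraph m n cross) := by
  refine isOuterplanar_of_noncrossing
    (pos := Sum.elim (fun i => (i : ℕ)) fun j => m + (j : ℕ)) ?_ ?_
  · rintro (i | i) (j | j) h <;> simp at h ⊢ <;> omega
  · rintro (⟨a, ha⟩ | ⟨a, ha⟩) (⟨b, hb⟩ | ⟨b, hb⟩) (⟨c, hc⟩ | ⟨c, hc⟩) (⟨d, hd⟩ | ⟨d, hd⟩) h1 h2 <;>
      simp at h1 h2 ⊢ <;> try omega
    have := h _ h1 _ h2
    simp at this
    omega

theorem isOuterplanar_ladderGraph_of_mono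
    (h : ∀ e ∈ cross, ∀ e' ∈ cross, e.1 < e'.1 → ¬ e'.2 < e.2) :
    IsOuterplanar (ladderGraph m n cross) := by
  refine isOuterplanar_of_noncrossing
    (pos := Sum.elim (fun i => (i : ℕ)) fun j => m + (n - (j : ℕ))) ?_ ?_
  · rintro (i | i) (j | j) h <;> simp at h ⊢ <;> omega
  · rintro (⟨a, ha⟩ | ⟨a, ha⟩) (⟨b, hb⟩ | ⟨b, hb⟩) (⟨c, hc⟩ | ⟨c, hc⟩) (⟨d, hd⟩ | ⟨d, hd⟩) h1 h2 <;>
      simp at h1 h2 ⊢ <;> try omega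
    have := h _ h1 _ h2
    simp at this
    omega

/-- The vertices of the ladder with index in `[a, b]` on the first path or in `[c, d]` on the
second one. -/
def ladderRegion (m n a b c d : ℕ) : Set (Fin m ⊕ Fin n) :=
  {v | v.elim (fun k : Fin m => a ≤ (k : ℕ) ∧ (k : ℕ) ≤ b)
    fun k : Fin n => c ≤ (k : ℕ) ∧ (k : ℕ) ≤ d}

@[simp]
theorem inl_mem_ladderRegion {a b c d : ℕ} {k : Fin m} :
    Sum.inl k ∈ ladderRegion m n a b c d ↔ a ≤ (k : ℕ) ∧ (k : ℕ) ≤ b := Iff.rfl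

@[simp]
theorem inr_mem_ladderRegion {a b c d : ℕ} {k : Fin n} :
    Sum.inr k ∈ ladderRegion m n a b c d ↔ c ≤ (k : ℕ) ∧ (k : ℕ) ≤ d := Iff.rfl

theorem exists_walk_segment {V : Type*} {G : SimpleGraph V} {k : ℕ} (α : Fin k → V)
    (hα : ∀ i j : Fin k, (i : ℕ) + 1 = j → G.Adj (α i) (α j)) (i j : Fin k) (hij : i ≤ j) :
    ∃ p : G.Walk (α i) (α j), ∀ v ∈ p.support, ∃ l, i ≤ l ∧ l ≤ j ∧ v = α l := by
  obtain ⟨j, hj⟩ := j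
  induction j with
  | zero =>
    obtain rfl : i = ⟨0, hj⟩ := le_antisymm hij (Fin.mk_le_of_le_val (Nat.zero_le _))
    exact ⟨.nil, fun v hv => ⟨_, le_rfl, le_rfl, by simpa using hv⟩⟩
  | succ j ih =>
    rcases hij.eq_or_lt with rfl | hlt
    · exact ⟨.nil, fun v hv => ⟨_, le_rfl, le_rfl, by simpa using hv⟩⟩
    · have hlt' : (i : ℕ) < j + 1 := hlt
      obtain ⟨p, hp⟩ := ih (by omega) (Fin.le_def.2 (Nat.lt_succ_iff.1 hlt'))
      refine ⟨p.concat (hα _ _ rfl), fun v hv => ?_⟩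
      rw [Walk.support_concat, List.mem_append, List.mem_singleton] at hv
      rcases hv with hv | rfl
      · obtain ⟨l, h1, h2, rfl⟩ := hp v hv
        exact ⟨l, h1, h2.trans (Fin.mk_le_mk.2 (Nat.le_succ j)), rfl⟩
      · exact ⟨_, hij, le_rfl, rfl⟩

theorem exists_walk_inl {i j : Fin m} (hij : i ≤ j) {a b c d : ℕ} (ha : a ≤ i) (hb : j ≤ b) :
    ∃ p : (ladderGraph m n cross).Walk (.inl i) (.inl j),
      ∀ v ∈ p.support, v ∈ ladderRegion m n a b c d := by
  obtain ⟨p, hp⟩ := exists_walk_segment (G := ladderGraph m n cross) Sum.inl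
    (fun i j h => by simp [h]) i j hij
  refine ⟨p, fun v hv => ?_⟩
  obtain ⟨l, h1, h2, rfl⟩ := hp v hv
  simp only [inl_mem_ladderRegion]
  omega

theorem exists_walk_inr {i j : Fin n} (hij : i ≤ j) {a b c d : ℕ} (hc : c ≤ i) (hd : j ≤ d) :
    ∃ p : (ladderGraph m n cross).Walk (.inr i) (.inr j),
      ∀ v ∈ p.support, v ∈ ladderRegion m n a b c d := by
  obtain ⟨p, hp⟩ := exists_walk_segment (G := ladderGraph m n cross) Sum.inr
    (fun i j h => by simp [h]) i j hij
  refine ⟨p, fun v hv => ?_⟩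
  obtain ⟨l, h1, h2, rfl⟩ := hp v hv
  simp only [inr_mem_ladderRegion]
  omega

theorem exists_walk_cross {i : Fin m} {j : Fin n} (h : (i, j) ∈ cross) {a b c d : ℕ}
    (ha : a ≤ i) (hb : i ≤ b) (hc : c ≤ j) (hd : j ≤ d) :
    ∃ p : (ladderGraph m n cross).Walk (.inl i) (.inr j),
      ∀ v ∈ p.support, v ∈ ladderRegion m n a b c d := by
  refine ⟨Walk.cons (ladderGraph_adj_inl_inr.2 h) .nil, fun v hv => ?_⟩
  simp only [Walk.support_cons, Walk.support_nil, List.mem_cons, List.not_mem_nil, or_false] at hv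
  rcases hv with rfl | rfl
  · exact ⟨ha, hb⟩
  · exact ⟨hc, hd⟩

theorem not_isOuterplanar_of_four {a c : Fin m} {b d : Fin n} (hac : a < c) (hbd : b < d)
    (hab : (a, b) ∈ cross) (had : (a, d) ∈ cross) (hcb : (c, b) ∈ cross) (hcd : (c, d) ∈ cross) :
    ¬ IsOuterplanar (ladderGraph m n cross) := by
  refine fun hG => hG.1 (containsSubdivision_of_regions
    ![.inl a, .inl c, .inr b, .inr d] ?_
    (![0, 2, 0, 0, 1, 1] : Fin 6 → Fin 4) ![1, 3, 2, 3, 2, 3]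
    ![ladderRegion m n a c 1 0, ladderRegion m n 1 0 b d, ladderRegion m n a a b b,
      ladderRegion m n a a d d, ladderRegion m n c c b b, ladderRegion m n c c d d]
    ?_ ?_ ?_ ?_)
  · intro i j h
    fin_cases i <;> fin_cases j <;> simp_all [Fin.ext_iff] <;> omega
  · intro i j h
    simp only [completeGraph, top_adj] at h
    revert i j
    decide
  · intro e
    fin_cases e
    · exact exists_walk_inl hac.le le_rfl le_rfl
    · exact exists_walk_inr hbd.le le_rfl le_rfl
    · exact exists_walk_cross hab le_rfl le_rfl le_rfl le_rfl
    · exact exists_walk_cross had le_rfl le_rfl le_rfl le_rfl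
    · exact exists_walk_cross hcb le_rfl le_rfl le_rfl le_rfl
    · exact exists_walk_cross hcd le_rfl le_rfl le_rfl le_rfl
  · intro e w
    fin_cases e <;> fin_cases w <;> simp <;> omega
  · intro e e' h v
    fin_cases e <;> fin_cases e' <;> rcases v with v | v <;> simp [Fin.ext_iff] at h ⊢ <;> omega

set_option maxHeartbeats 1000000 in
theorem not_isOuterplanar_of_fork {a c p : Fin m} {b d q : Fin n}
    (hac : a < c) (hap : a < p) (hbd : b < d) (hqb : q < b)
    (hab : (a, b) ∈ cross) (hcd : (c, d) ∈ cross) (hpq : (p, q) ∈ cross) :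
    ¬ IsOuterplanar (ladderGraph m n cross) := by
  obtain ⟨h, hhc, hhp, hh⟩ : ∃ h : Fin m, h ≤ c ∧ h ≤ p ∧ (h = c ∨ h = p) :=
    ⟨min c p, min_le_left _ _, min_le_right _ _, min_choice c p⟩
  have hah : a < h := by rcases hh with rfl | rfl <;> assumption
  have arm : ∀ {x : Fin m} {y : Fin n}, h ≤ x → (x, y) ∈ cross →
      ∃ w : (ladderGraph m n cross).Walk (.inr y) (.inl h),
        ∀ v ∈ w.support, v ∈ ladderRegion m n h x y y := by
    intro x y hx hxy
    obtain ⟨w₁, hw₁⟩ := exists_walk_cross hxy (a := h) (b := x) (c := y) (d := y) hx le_rfl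
      le_rfl le_rfl
    obtain ⟨w₂, hw₂⟩ := exists_walk_inl (cross := cross) hx (a := h) (b := x) (c := y) (d := y)
      le_rfl le_rfl
    refine ⟨(w₂.append w₁).reverse, fun v hv => ?_⟩
    rw [Walk.support_reverse, List.mem_reverse, Walk.mem_support_append_iff] at hv
    exact hv.elim (hw₂ v) (hw₁ v)
  refine fun hG => hG.2 (containsSubdivision_of_regions
    (Sum.elim ![.inr d, .inr q, .inl a] ![.inr b, .inl h]) ?_
    (![.inr 0, .inl 0, .inl 1, .inl 1, .inl 2, .inl 2] : Fin 6 → Fin 3 ⊕ Fin 2)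
    ![.inl 0, .inr 1, .inr 0, .inr 1, .inr 0, .inr 1]
    ![ladderRegion m n 1 0 b d, ladderRegion m n h c d d, ladderRegion m n 1 0 q b,
      ladderRegion m n h p q q, ladderRegion m n a a b b, ladderRegion m n a h 1 0]
    ?_ ?_ ?_ ?_)
  · rintro (i | i) (j | j) h <;> fin_cases i <;> fin_cases j <;> simp_all [Fin.ext_iff] <;> omega
  · rintro (i | i) (j | j) h <;> simp at h <;> clear h <;> revert i j <;> decide
  · intro e
    fin_cases e
    · exact exists_walk_inr hbd.le le_rfl le_rfl
    · exact arm hhc hcd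
    · exact exists_walk_inr hqb.le le_rfl le_rfl
    · exact arm hhp hpq
    · exact exists_walk_cross hab le_rfl le_rfl le_rfl le_rfl
    · exact exists_walk_inl hah.le le_rfl le_rfl
  · rintro e (w | w) <;> fin_cases e <;> fin_cases w <;> simp <;> omega
  · intro e e' hne v
    clear arm hG hab hcd hpq
    rw [Fin.ext_iff, Fin.ext_iff] at hh
    fin_cases e <;> fin_cases e' <;> rcases v with v | v <;> simp [Fin.ext_iff] at hne ⊢ <;> omega

theorem IsOuterplanar.ladderGraph_swap (h : IsOuterplanar (ladderGraph m n cross)) :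
    IsOuterplanar (ladderGraph n m (cross.image Prod.swap)) := by
  refine h.of_injective_hom ⟨Sum.swap, ?_⟩ Sum.swap_leftInverse.injective
  rintro (i | i) (j | j) <;> simp

theorem IsOuterplanar.ladderGraph_rev (h : IsOuterplanar (ladderGraph m n cross)) :
    IsOuterplanar (ladderGraph m n (cross.image (Prod.map Fin.rev Fin.rev))) := by
  refine h.of_injective_hom ⟨Sum.map Fin.rev Fin.rev, ?_⟩
    (Function.Injective.sumMap Fin.rev_injective Fin.rev_injective)
  have key : ∀ (x : Fin m) (y : Fin n), (x, y) ∈ cross.image (Prod.map Fin.rev Fin.rev) →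
      (x.rev, y.rev) ∈ cross := by
    intro x y hxy
    simp only [Finset.mem_image, Prod.exists, Prod.map_apply, Prod.mk.injEq] at hxy
    obtain ⟨a, b, hab, rfl, rfl⟩ := hxy
    simpa using hab
  rintro (i | i) (j | j) hij
  · simp [Fin.val_rev] at hij ⊢
    omega
  · exact ladderGraph_adj_inl_inr.2 (key _ _ (ladderGraph_adj_inl_inr.1 hij))
  · exact ladderGraph_adj_inr_inl.2 (key _ _ (ladderGraph_adj_inr_inl.1 hij))
  · simp [Fin.val_rev] at hij ⊢
    omega

theorem not_isOuterplanar_of_up {e f g : Fin m × Fin n} (he : e ∈ cross) (hf : f ∈ cross)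
    (hg : g ∈ cross) (hef : e.1 < f.1 ∧ e.2 < f.2)
    (heg : e.1 < g.1 ∧ g.2 < e.2 ∨ g.1 < e.1 ∧ e.2 < g.2) :
    ¬ IsOuterplanar (ladderGraph m n cross) := by
  rcases heg with heg | heg
  · exact not_isOuterplanar_of_fork hef.1 heg.1 hef.2 heg.2 he hf hg
  · refine fun h => not_isOuterplanar_of_fork hef.2 heg.2 hef.1 heg.1 ?_ ?_ ?_ h.ladderGraph_swap
    · exact Finset.mem_image_of_mem Prod.swap he
    · exact Finset.mem_image_of_mem Prod.swap hf
    · exact Finset.mem_image_of_mem Prod.swap hg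

theorem not_isOuterplanar_of_three {e f g : Fin m × Fin n} (he : e ∈ cross) (hf : f ∈ cross)
    (hg : g ∈ cross) (hef : e.1 < f.1 ∧ e.2 < f.2 ∨ f.1 < e.1 ∧ f.2 < e.2)
    (heg : e.1 < g.1 ∧ g.2 < e.2 ∨ g.1 < e.1 ∧ e.2 < g.2) :
    ¬ IsOuterplanar (ladderGraph m n cross) := by
  rcases hef with hef | hef
  · exact not_isOuterplanar_of_up he hf hg hef heg
  · refine fun h => not_isOuterplanar_of_up (Finset.mem_image_of_mem _ he)
      (Finset.mem_image_of_mem _ hf) (Finset.mem_image_of_mem _ hg) ?_ ?_ h.ladderGraph_rev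
    · simpa using hef
    · simpa using heg.symm

end Ladder

theorem mono_or_anti_of_isOuterplanar {m n : ℕ} {cross : Finset (Fin m × Fin n)}
    (h : IsOuterplanar (ladderGraph m n cross)) :
    (∀ e ∈ cross, ∀ e' ∈ cross, e.1 < e'.1 → ¬ e.2 < e'.2) ∨
      ∀ e ∈ cross, ∀ e' ∈ cross, e.1 < e'.1 → ¬ e'.2 < e.2 := by
  by_contra! hcon
  obtain ⟨⟨⟨a, b⟩, h1, ⟨c, d⟩, h2, hac, hbd⟩, ⟨⟨p, q⟩, h3, ⟨r, s⟩, h4, hpr, hsq⟩⟩ := hcon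
  have t : ∀ e f g, e ∈ cross → f ∈ cross → g ∈ cross →
      ¬ ((e.1 < f.1 ∧ e.2 < f.2 ∨ f.1 < e.1 ∧ f.2 < e.2) ∧
        (e.1 < g.1 ∧ g.2 < e.2 ∨ g.1 < e.1 ∧ e.2 < g.2)) :=
    fun e f g he hf hg hh => not_isOuterplanar_of_three he hf hg hh.1 hh.2 h
  have t1 := t _ _ _ h1 h2 h3
  have t2 := t _ _ _ h1 h2 h4
  have t3 := t _ _ _ h2 h1 h3
  have t4 := t _ _ _ h2 h1 h4
  have t5 := t _ _ _ h3 h1 h4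
  have t6 := t _ _ _ h3 h2 h4
  have t7 := t _ _ _ h4 h1 h3
  have t8 := t _ _ _ h4 h2 h3
  simp only at hac hbd hpr hsq t1 t2 t3 t4 t5 t6 t7 t8
  obtain ⟨rfl, rfl, rfl, rfl⟩ : p = a ∧ q = d ∧ r = c ∧ s = b := by omega
  exact not_isOuterplanar_of_four hac hbd h1 h3 h4 h2 h

/-- **Theorem (outerplanarity of generalized ladder graphs).**
A generalized (m,n)-ladder graph is outerplanar iff either
(i) `L↑(e) ∩ R↑(e) = L↓(e) ∩ R↓(e) = ∅` for each cross edge `e`, or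
(ii) `L↑(e) ∩ R↓(e) = L↓(e) ∩ R↑(e) = ∅` for each cross edge `e`. -/
theorem ladder_outerplanar_iff (m n : ℕ) (hm : 0 < m) (hn : 0 < n)
    (cross : Finset (Fin m × Fin n)) :
    IsOuterplanar (ladderGraph m n cross) ↔
      ((∀ e ∈ cross,
          Lup cross e ∩ Rup cross e = ∅ ∧ Ldown cross e ∩ Rdown cross e = ∅) ∨
       (∀ e ∈ cross,
          Lup cross e ∩ Rdown cross e = ∅ ∧ Ldown cross e ∩ Rup cross e = ∅)) := by
  simp only [Finset.eq_empty_iff_forall_notMem, Finset.mem_inter, Lup, Rup, Ldown, Rdown,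
    Finset.mem_filter]
  constructor
  · intro h
    refine (mono_or_anti_of_isOuterplanar h).imp ?_ ?_
    · exact fun h e he => ⟨fun e' h' => h e he e' h'.1.1 h'.1.2 h'.2.2,
        fun e' h' => h e' h'.1.1 e he h'.1.2 h'.2.2⟩
    · exact fun h e he => ⟨fun e' h' => h e he e' h'.1.1 h'.1.2 h'.2.2,
        fun e' h' => h e' h'.1.1 e he h'.1.2 h'.2.2⟩
  · rintro (h | h)
    · exact isOuterplanar_ladderGraph_of_anti fun e he e' he' h1 h2 =>
        (h e he).1 e' ⟨⟨he', h1⟩, he', h2⟩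
    · exact isOuterplanar_ladderGraph_of_mono fun e he e' he' h1 h2 =>
        (h e he).1 e' ⟨⟨he', h1⟩, he', h2⟩
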